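/- Let d, k ≥ 1, let V ⊆ ℝ^d, let C, α > 0, and suppose f₁, …, f_k : V → ℝ are each (C,α)-good on V. Then the function x ↦ (f₁(x)² + ⋯ + f_k(x)²)^{1/2} is (k^{α/2}C, α)-good on V. -/

import Mathlib

open MeasureTheory

/-- f is (C,α)-good on V ⊆ ℝ^d. -/
def IsGood {d : ℕ} (C α : ℝ) (V : Set (Fin d → ℝ)) (f : (Fin d → ℝ) → ℝ) : Prop :=
  ∀ (x : Fin d → ℝ) (r : ℝ), Metric.ball x r ⊆ V → ∀ ε : ℝ, 0 < ε →
    volume {y ∈ Metric.ball x r | |f y| < ε * ⨆ w ∈ Metric.ball x r, |f w|} ≤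
      ENNReal.ofReal (C * ε ^ α) * volume (Metric.ball x r)

theorem good_sqrt_sum_sq (d k : ℕ) (hd : 1 ≤ d) (hk : 1 ≤ k)
    (V : Set (Fin d → ℝ)) (C α : ℝ) (hC : 0 < C) (hα : 0 < α)
    (f : Fin k → (Fin d → ℝ) → ℝ) (hf : ∀ i, IsGood C α V (f i)) :
    IsGood ((k : ℝ) ^ (α / 2) * C) α V (fun x => Real.sqrt (∑ i, f i x ^ 2)) := by
  intro x r hV ε hε
  set B := Metric.ball x r with hB
  set g : (Fin d → ℝ) → ℝ := fun x => Real.sqrt (∑ i, f i x ^ 2) with hg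
  have hfg : ∀ i y, |f i y| ≤ |g y| := by
    intro i y
    rw [abs_of_nonneg (Real.sqrt_nonneg _ : 0 ≤ g y)]
    apply Real.le_sqrt_of_sq_le
    rw [sq_abs]
    exact Finset.single_le_sum (f := fun i => f i y ^ 2) (fun j _ => sq_nonneg _) (Finset.mem_univ i)
  by_cases hbdd : BddAbove (Set.range fun w => ⨆ (_ : w ∈ B), |g w|)
  swap
  · have h0 : (⨆ w ∈ B, |g w|) = 0 := Real.iSup_of_not_bddAbove hbdd
    have he : {y ∈ B | |g y| < ε * ⨆ w ∈ B, |g w|} = ∅ := by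
      ext y
      simp only [h0, mul_zero, Set.mem_setOf_eq, Set.mem_empty_iff_false, iff_false, not_and, not_lt]
      intro _
      exact abs_nonneg _
    change volume {y ∈ B | |g y| < ε * ⨆ w ∈ B, |g w|} ≤ _
    rw [he]; simp
  have hbf : ∀ i, BddAbove (Set.range fun w => ⨆ (_ : w ∈ B), |f i w|) := by
    intro i
    obtain ⟨M, hM⟩ := hbdd
    refine ⟨M, ?_⟩
    rintro _ ⟨w, rfl⟩
    refine le_trans ?_ (hM ⟨w, rfl⟩)
    by_cases hw : w ∈ B <;> simp [hw, hfg]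
  have hle : ∀ i, ∀ w ∈ B, |f i w| ≤ ⨆ w ∈ B, |f i w| := by
    intro i w hw
    have := le_ciSup (hbf i) w
    simpa [hw] using this
  haveI : Nonempty (Fin k) := ⟨⟨0, hk⟩⟩
  obtain ⟨i, hi⟩ := Finite.exists_max (fun i => ⨆ w ∈ B, |f i w|)
  have hS0 : 0 ≤ ⨆ w ∈ B, |f i w| :=
    Real.iSup_nonneg fun w => Real.iSup_nonneg fun _ => abs_nonneg _
  have hG : (⨆ w ∈ B, |g w|) ≤ Real.sqrt k * ⨆ w ∈ B, |f i w| := by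
    have hn : 0 ≤ Real.sqrt k * ⨆ w ∈ B, |f i w| := mul_nonneg (Real.sqrt_nonneg _) hS0
    refine Real.iSup_le (fun w => Real.iSup_le (fun hw => ?_) hn) hn
    rw [abs_of_nonneg (Real.sqrt_nonneg _ : 0 ≤ g w)]
    apply Real.sqrt_le_iff.2 ⟨hn, ?_⟩
    rw [mul_pow, Real.sq_sqrt (Nat.cast_nonneg k)]
    have : ∑ j, f j w ^ 2 ≤ ∑ j : Fin k, (⨆ w ∈ B, |f i w|) ^ 2 := by
      refine Finset.sum_le_sum fun j _ => ?_
      rw [← sq_abs]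
      exact pow_le_pow_left₀ (abs_nonneg _) ((hle j w hw).trans (hi j)) 2
    simpa using this
  have hk0 : (0 : ℝ) < k := by exact_mod_cast hk
  have key := hf i x r hV (ε * Real.sqrt k) (mul_pos hε (Real.sqrt_pos.2 hk0))
  have hc : C * (ε * Real.sqrt k) ^ α = (k : ℝ) ^ (α / 2) * C * ε ^ α := by
    rw [Real.mul_rpow hε.le (Real.sqrt_nonneg _), Real.sqrt_eq_rpow, ← Real.rpow_mul hk0.le]
    rw [show 1 / 2 * α = α / 2 by ring]
    ring
  rw [hc] at key
  refine le_trans (measure_mono ?_) key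
  rintro y ⟨hy, hlt⟩
  refine ⟨hy, ?_⟩
  calc |f i y| ≤ |g y| := hfg i y
    _ < ε * ⨆ w ∈ B, |g w| := hlt
    _ ≤ ε * (Real.sqrt k * ⨆ w ∈ B, |f i w|) := mul_le_mul_of_nonneg_left hG hε.le
    _ = _ := by rw [mul_assoc]
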